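/- Let F be an algebraically closed field of characteristic zero, and consider the eight homogeneous polynomials in the six variables ω₁, ..., ω₆: f₁ = ω₁ω₆ − ω₂ω₄, f₂ = ω₂² − ω₁ω₃, f₃ = ω₂ω₃ − ω₁ω₅, f₄ = ω₂ω₅ − ω₃², f₅ = ω₂ω₆ − ω₃ω₄, f₆ = ω₃ω₆ − ω₄ω₅, f₇ = ω₄³ − ω₃²ω₅ + ω₁³, f₈ = ω₅³ − ω₄ω₆² − ω₁ω₂². Then for every nonzero point a = (a₁, ..., a₆) ∈ F⁶ with f₁(a) = f₂(a) = ... = f₈(a) = 0, the 8 × 6 Jacobian matrix whose (i, j) entry is ∂f_i/∂ω_j evaluated at a has rank exactly 4; in particular, the projective variety in P⁵ defined by f₁, ..., f₈ is a smooth curve. -/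

import Mathlib

open MvPolynomial

/-- A matrix that factors through `Fin k` and has a nonzero `k × k` minor has rank `k`. -/
theorem Matrix.rank_eq_of_eq_mul_of_det_submatrix_ne_zero {F m n : Type*} [Field F]
    [Fintype m] [Fintype n] {k : ℕ} (M : Matrix m n F) (A : Matrix m (Fin k) F)
    (B : Matrix (Fin k) n F) (hM : M = A * B) (r : Fin k → m) (c : Fin k → n)
    (hdet : (M.submatrix r c).det ≠ 0) : M.rank = k := by
  apply le_antisymm
  · rw [hM]
    exact (Matrix.rank_mul_le_left A B).trans
      ((Matrix.rank_le_card_width A).trans_eq (Fintype.card_fin k))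
  · have h := Matrix.rank_of_isUnit (M.submatrix r c)
      ((Matrix.isUnit_iff_isUnit_det _).2 (isUnit_iff_ne_zero.2 hdet))
    rw [Fintype.card_fin] at h
    exact h.symm.le.trans (Matrix.rank_submatrix_le M r c)

/-- The Jacobian matrix of the eight defining polynomials of the canonical model. -/
def canonicalJacobian {F : Type*} [Field F] (a : Fin 6 → F) : Matrix (Fin 8) (Fin 6) F :=
  !![a 5, -a 3, 0, -a 1, 0, a 0;
     -a 2, 2 * a 1, -a 0, 0, 0, 0;
     -a 4, a 2, a 1, 0, -a 0, 0;
     0, a 4, -(2 * a 2), 0, a 1, 0;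
     0, a 5, -a 3, -a 2, 0, a 1;
     0, 0, a 5, -a 4, -a 3, a 2;
     3 * a 0 ^ 2, 0, -(2 * a 2 * a 4), 3 * a 3 ^ 2, -a 2 ^ 2, 0;
     -a 1 ^ 2, -(2 * a 0 * a 1), 0, -a 5 ^ 2, 3 * a 4 ^ 2, -(2 * a 3 * a 5)]

/-- The rank of the Jacobian at the affine point `(x, y)`, scaled by `c`. -/
theorem rank_canonicalJacobian_affine {F : Type*} [Field F] [CharZero F] (c x y : F)
    (hc : c ≠ 0) (hxy : y ^ 3 = x ^ 7 - 1) :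
    (canonicalJacobian ![c, c * x, c * x ^ 2, c * y, c * x ^ 3, c * x * y]).rank = 4 := by
  have hfac : canonicalJacobian ![c, c * x, c * x ^ 2, c * y, c * x ^ 3, c * x * y] =
      !![1, 0, 0, 0;
         0, 1, 0, 0;
         0, 0, 1, 0;
         0, x ^ 2, -x, 0;
         x, y, 0, 0;
         x ^ 2, 0, y, 0;
         0, 0, 0, 1;
         -(2 * c * x * y ^ 2), 0, -(2 * c * x ^ 6), -x ^ 2] *
      (canonicalJacobian ![c, c * x, c * x ^ 2, c * y, c * x ^ 3, c * x * y]).submatrix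
        ![0, 1, 2, 6] id := by
    ext i j
    rw [Matrix.mul_apply, Fin.sum_univ_four]
    fin_cases i <;> fin_cases j <;>
      simp [canonicalJacobian] <;> grind
  by_cases hy : y = 0
  · have hx : x ≠ 0 := by
      rintro rfl
      simp [hy] at hxy
    refine Matrix.rank_eq_of_eq_mul_of_det_submatrix_ne_zero _ _ _ hfac
      ![0, 1, 2, 6] ![1, 2, 4, 5] ?_
    have hminor : (canonicalJacobian ![c, c * x, c * x ^ 2, c * y, c * x ^ 3, c * x * y]).submatrix
        ![0, 1, 2, 6] ![1, 2, 4, 5] =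
        !![-(c * y), 0, 0, c;
           2 * c * x, -c, 0, 0;
           c * x ^ 2, c * x, -c, 0;
           0, -(2 * c ^ 2 * x ^ 5), -(c ^ 2 * x ^ 4), 0] := by
      ext i j
      fin_cases i <;> fin_cases j <;> simp [canonicalJacobian] <;> ring
    have hdet : ((canonicalJacobian ![c, c * x, c * x ^ 2, c * y, c * x ^ 3, c * x * y]).submatrix
        ![0, 1, 2, 6] ![1, 2, 4, 5]).det = 7 * c ^ 5 * x ^ 6 := by
      rw [hminor]
      simp [Matrix.det_succ_row_zero, Fin.sum_univ_succ, Fin.succAbove]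
      ring
    rw [hdet]
    simp [hc, hx]
  · refine Matrix.rank_eq_of_eq_mul_of_det_submatrix_ne_zero _ _ _ hfac
      ![0, 1, 2, 6] ![2, 3, 4, 5] ?_
    have hminor : (canonicalJacobian ![c, c * x, c * x ^ 2, c * y, c * x ^ 3, c * x * y]).submatrix
        ![0, 1, 2, 6] ![2, 3, 4, 5] =
        !![0, -(c * x), 0, c;
           -c, 0, 0, 0;
           c * x, 0, -c, 0;
           -(2 * c ^ 2 * x ^ 5), 3 * c ^ 2 * y ^ 2, -(c ^ 2 * x ^ 4), 0] := by
      ext i j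
      fin_cases i <;> fin_cases j <;> simp [canonicalJacobian] <;> ring
    have hdet : ((canonicalJacobian ![c, c * x, c * x ^ 2, c * y, c * x ^ 3, c * x * y]).submatrix
        ![0, 1, 2, 6] ![2, 3, 4, 5]).det = 3 * c ^ 5 * y ^ 2 := by
      rw [hminor]
      simp [Matrix.det_succ_row_zero, Fin.sum_univ_succ, Fin.succAbove]
      ring
    rw [hdet]
    simp [hc, hy]

/-- The rank of the Jacobian at the point at infinity. -/
theorem rank_canonicalJacobian_infinity {F : Type*} [Field F] (e : F) (he : e ≠ 0) :
    (canonicalJacobian ![0, 0, 0, 0, 0, e]).rank = 4 := by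
  have hfac : canonicalJacobian ![0, 0, 0, 0, 0, e] =
      !![1, 0, 0, 0;
         0, 0, 0, 0;
         0, 0, 0, 0;
         0, 0, 0, 0;
         0, 1, 0, 0;
         0, 0, 1, 0;
         0, 0, 0, 0;
         0, 0, 0, (1 : F)] *
      (canonicalJacobian ![0, 0, 0, 0, 0, e]).submatrix ![0, 4, 5, 7] id := by
    ext i j
    rw [Matrix.mul_apply, Fin.sum_univ_four]
    fin_cases i <;> fin_cases j <;>
      simp [canonicalJacobian]
  refine Matrix.rank_eq_of_eq_mul_of_det_submatrix_ne_zero _ _ _ hfac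
    ![0, 4, 5, 7] ![0, 1, 2, 3] ?_
  have hminor : (canonicalJacobian ![0, 0, 0, 0, 0, e]).submatrix
      ![0, 4, 5, 7] ![0, 1, 2, 3] = Matrix.diagonal ![e, e, e, -e ^ 2] := by
    ext i j
    fin_cases i <;> fin_cases j <;> simp [canonicalJacobian]
  rw [hminor, Matrix.det_diagonal, Finset.prod_ne_zero_iff]
  intro i _
  fin_cases i <;> simp [he]

/-- At every nonzero common zero of the eight quadrics/cubics defining
the canonical model of `x⁷ - y³ - 1 = 0` in `P⁵`, the `8 × 6` Jacobian matrix has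
rank exactly `4`; in particular the projective variety they define is a smooth curve. -/
theorem canonical_model_jacobian_rank_four
    (F : Type*) [Field F] [IsAlgClosed F] [CharZero F]
    (f : Fin 8 → MvPolynomial (Fin 6) F)
    (hf : f = ![X 0 * X 5 - X 1 * X 3,
                X 1 ^ 2 - X 0 * X 2,
                X 1 * X 2 - X 0 * X 4,
                X 1 * X 4 - X 2 ^ 2,
                X 1 * X 5 - X 2 * X 3,
                X 2 * X 5 - X 3 * X 4,
                X 3 ^ 3 - X 2 ^ 2 * X 4 + X 0 ^ 3,
                X 4 ^ 3 - X 3 * X 5 ^ 2 - X 0 * X 1 ^ 2])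
    (a : Fin 6 → F) (ha : a ≠ 0)
    (hza : ∀ i : Fin 8, eval a (f i) = 0) :
    Matrix.rank (Matrix.of fun (i : Fin 8) (j : Fin 6) => eval a (pderiv j (f i))) = 4 := by
  have hJ : (Matrix.of fun (i : Fin 8) (j : Fin 6) => eval a (pderiv j (f i))) =
      canonicalJacobian a := by
    subst hf
    ext i j
    fin_cases i <;> fin_cases j <;>
      simp [canonicalJacobian, pderiv_X, Derivation.leibniz_pow] <;> ring
  rw [hJ]
  have h0 := hza 0
  have h1 := hza 1
  have h2 := hza 2
  have h3 := hza 3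
  have h6 := hza 6
  have h7 := hza 7
  simp [hf] at h0 h1 h2 h3 h6 h7
  by_cases hc : a 0 = 0
  · have e1 : a 1 = 0 := by simpa [hc] using h1
    have e2 : a 2 = 0 := by simpa [e1] using h3
    have e3 : a 3 = 0 := by simpa [hc, e2] using h6
    have e4 : a 4 = 0 := by simpa [hc, e3] using h7
    have hvec : a = ![0, 0, 0, 0, 0, a 5] := by
      ext i
      fin_cases i <;> simp [hc, e1, e2, e3, e4]
    have e5 : a 5 ≠ 0 := by
      intro h
      apply ha
      ext i
      fin_cases i <;> simp [hc, e1, e2, e3, e4, h]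
    rw [hvec]
    exact rank_canonicalJacobian_infinity _ e5
  · obtain ⟨x, hx⟩ : ∃ x, a 1 = a 0 * x := ⟨a 1 / a 0, by field_simp⟩
    obtain ⟨y, hy⟩ : ∃ y, a 3 = a 0 * y := ⟨a 3 / a 0, by field_simp⟩
    have e2 : a 2 = a 0 * x ^ 2 := by
      apply mul_left_cancel₀ hc
      rw [hx] at h1
      linear_combination -h1
    have e4 : a 4 = a 0 * x ^ 3 := by
      apply mul_left_cancel₀ hc
      rw [hx, e2] at h2
      linear_combination -h2
    have e5 : a 5 = a 0 * x * y := by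
      apply mul_left_cancel₀ hc
      rw [hx, hy] at h0
      linear_combination h0
    have hxy : y ^ 3 = x ^ 7 - 1 := by
      apply mul_left_cancel₀ (pow_ne_zero 3 hc)
      rw [hy, e2, e4] at h6
      linear_combination h6
    have hvec : a = ![a 0, a 0 * x, a 0 * x ^ 2, a 0 * y, a 0 * x ^ 3, a 0 * x * y] := by
      ext i
      fin_cases i
      exacts [rfl, hx, e2, hy, e4, e5]
    rw [hvec]
    exact rank_canonicalJacobian_affine _ x y hc hxy
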